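/- arXiv:2110.06520 — 6 statements merged into one kernel-verified Lean document; each statement's English description precedes it below -/
import Mathlib

section
/- For every α ∈ (0,1), the expected delivered quality G is differentiable at α with derivative G′(α) = −q_max·e^{−k(α)}; in particular G′(α) < 0. -/
open Real MeasureTheory

/-- Channel capacity `C(u) = B·log₂(1 + Ψ·u/(r^β·(Υ+1)))`. -/
noncomputable def Cchan (B Psi Ups r β : ℝ) (u : ℝ) : ℝ :=
  B * Real.logb 2 (1 + Psi * u / (r ^ β * (Ups + 1)))

/-- Threshold `k(α) = r^β·((Υ+1)/Ψ)·(2^{A·q_max·(1−α)/(T·B)} − 1)`. -/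
noncomputable def kThr (B Psi Ups T A qmax r β : ℝ) (α : ℝ) : ℝ :=
  r ^ β * ((Ups + 1) / Psi) * ((2 : ℝ) ^ (A * qmax * (1 - α) / (T * B)) - 1)

/-- Expected delivered quality `G(α) = ∫₀^∞ min{C(u)·T/A, q_max·(1−α)}·e^{−u} du`. -/
noncomputable def Gfun (B Psi Ups T A qmax r β : ℝ) (α : ℝ) : ℝ :=
  ∫ u in Set.Ioi (0 : ℝ),
    min (Cchan B Psi Ups r β u * T / A) (qmax * (1 - α)) * Real.exp (-u)

lemma key_lt (B Psi Ups T A qmax r β : ℝ)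
    (hB : 0 < B) (hPsi : 0 < Psi) (hUps : 0 < Ups) (hT : 0 < T)
    (hA : 0 < A) (hr : 0 < r) (α u : ℝ) (hu : 0 < u) :
    (Cchan B Psi Ups r β u * T / A < qmax * (1 - α) ↔ u < kThr B Psi Ups T A qmax r β α) ∧
    (qmax * (1 - α) < Cchan B Psi Ups r β u * T / A ↔ kThr B Psi Ups T A qmax r β α < u) := by
  have hR : 0 < r ^ β := Real.rpow_pos_of_pos hr β
  have hU : 0 < Ups + 1 := by linarith
  have hx : 0 < 1 + Psi * u / (r ^ β * (Ups + 1)) := by positivity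
  unfold Cchan kThr
  set L := Real.logb 2 (1 + Psi * u / (r ^ β * (Ups + 1))) with hL
  set y := A * qmax * (1 - α) / (T * B) with hy
  have e1 : B * L * T / A = (B * T / A) * L := by ring
  have e2 : qmax * (1 - α) = (B * T / A) * y := by rw [hy]; field_simp
  have hc : 0 < B * T / A := by positivity
  have hD : 0 < r ^ β * ((Ups + 1) / Psi) := by positivity
  have e3 : u = r ^ β * ((Ups + 1) / Psi) * (Psi * u / (r ^ β * (Ups + 1))) := by
    field_simp
  rw [e1, e2, mul_lt_mul_iff_right₀ hc, mul_lt_mul_iff_right₀ hc, hL,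
    Real.logb_lt_iff_lt_rpow (by norm_num) hx, Real.lt_logb_iff_rpow_lt (by norm_num) hx]
  constructor
  · conv_rhs => rw [e3]
    rw [mul_lt_mul_iff_right₀ hD, lt_sub_iff_add_lt']
  · conv_rhs => rw [e3]
    rw [mul_lt_mul_iff_right₀ hD, sub_lt_iff_lt_add']

theorem stmt_3 (B Psi Ups T A qmax r β : ℝ)
    (hB : 0 < B) (hPsi : 0 < Psi) (hUps : 0 < Ups) (hT : 0 < T)
    (hA : 0 < A) (hq : 0 < qmax) (hr : 0 < r) (hβ : 0 < β) :
    ∀ α ∈ Set.Ioo (0 : ℝ) 1,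
      HasDerivAt (Gfun B Psi Ups T A qmax r β)
        (-(qmax * Real.exp (-(kThr B Psi Ups T A qmax r β α)))) α ∧
      -(qmax * Real.exp (-(kThr B Psi Ups T A qmax r β α))) < 0 := by
  intro α hα
  have hneg : -(qmax * Real.exp (-(kThr B Psi Ups T A qmax r β α))) < 0 := by
    have : 0 < qmax * Real.exp (-(kThr B Psi Ups T A qmax r β α)) := by positivity
    linarith
  refine ⟨?_, hneg⟩
  have hR : 0 < r ^ β := Real.rpow_pos_of_pos hr β
  have key := fun u hu => key_lt B Psi Ups T A qmax r β hB hPsi hUps hT hA hr α u hu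
  have hk : 0 < kThr B Psi Ups T A qmax r β α := by
    unfold kThr
    have h1 : 0 < 1 - α := by linarith [hα.2]
    have : (1 : ℝ) < 2 ^ (A * qmax * (1 - α) / (T * B)) :=
      Real.one_lt_rpow (by norm_num) (by positivity)
    have h2 : 0 < (2 : ℝ) ^ (A * qmax * (1 - α) / (T * B)) - 1 := by linarith
    positivity
  set k := kThr B Psi Ups T A qmax r β α with hkdef
  have hmeasC : Measurable (Cchan B Psi Ups r β) := by
    unfold Cchan Real.logb
    fun_prop
  have hmeas : ∀ x : ℝ, Measurable (fun u : ℝ =>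
      min (Cchan B Psi Ups r β u * T / A) (qmax * (1 - x)) * Real.exp (-u)) := by
    intro x
    fun_prop
  have hexp : Integrable (fun u : ℝ => Real.exp (-u)) (volume.restrict (Set.Ioi 0)) :=
    integrableOn_exp_neg_Ioi 0
  have hpos : ∀ u : ℝ, 0 < u → 0 ≤ Cchan B Psi Ups r β u * T / A := by
    intro u hu
    have : 0 ≤ Real.logb 2 (1 + Psi * u / (r ^ β * (Ups + 1))) := by
      apply Real.logb_nonneg (by norm_num)
      have : 0 ≤ Psi * u / (r ^ β * (Ups + 1)) := by positivity
      linarith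
    unfold Cchan
    positivity
  have main := hasDerivAt_integral_of_dominated_loc_of_lip
    (μ := volume.restrict (Set.Ioi (0 : ℝ))) (x₀ := α) (s := Set.univ)
    (F := fun x u => min (Cchan B Psi Ups r β u * T / A) (qmax * (1 - x)) * Real.exp (-u))
    (F' := (Set.Ioi k).indicator (fun u => -qmax * Real.exp (-u)))
    (bound := fun u => qmax * Real.exp (-u)) Filter.univ_mem
    (Filter.Eventually.of_forall fun x => (hmeas x).aestronglyMeasurable)
    ?_ ?_ ?_ (hexp.const_mul qmax) ?_
  · have h := main.2
    rw [integral_indicator measurableSet_Ioi, Measure.restrict_restrict measurableSet_Ioi,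
      Set.inter_eq_left.mpr (Set.Ioi_subset_Ioi hk.le), integral_const_mul,
      integral_exp_neg_Ioi, neg_mul] at h
    exact h
  · refine (hexp.const_mul (qmax * (1 - α))).mono' (hmeas α).aestronglyMeasurable ?_
    filter_upwards [ae_restrict_mem measurableSet_Ioi] with u hu
    have h1 : 0 ≤ qmax * (1 - α) := mul_nonneg hq.le (by linarith [hα.2])
    have h2 := le_min (hpos u hu) h1
    rw [Real.norm_eq_abs, abs_of_nonneg (mul_nonneg h2 (Real.exp_pos _).le)]
    exact mul_le_mul_of_nonneg_right (min_le_right _ _) (Real.exp_pos _).le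
  · exact (Measurable.indicator (by fun_prop) measurableSet_Ioi).aestronglyMeasurable
  · refine Filter.Eventually.of_forall fun u => ?_
    refine LipschitzOnWith.of_dist_le_mul fun x _ y _ => ?_
    have he := Real.exp_pos (-u)
    rw [Real.coe_nnabs, abs_of_pos (mul_pos hq he), Real.dist_eq, Real.dist_eq, ← sub_mul,
      abs_mul, abs_of_pos he]
    have h := abs_min_sub_min_le_max (Cchan B Psi Ups r β u * T / A) (qmax * (1 - x))
      (Cchan B Psi Ups r β u * T / A) (qmax * (1 - y))
    have h3 : |qmax * (1 - x) - qmax * (1 - y)| = qmax * |x - y| := by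
      rw [← mul_sub, abs_mul, abs_of_pos hq, abs_sub_comm x y]
      congr 2
      ring
    rw [sub_self, abs_zero, max_eq_right (abs_nonneg _), h3] at h
    calc _ ≤ qmax * |x - y| * Real.exp (-u) := mul_le_mul_of_nonneg_right h he.le
      _ = _ := by ring
  · have hne : ∀ᵐ u ∂(volume.restrict (Set.Ioi (0 : ℝ))), u ≠ k :=
      ae_restrict_of_ae (Measure.ae_ne volume k)
    filter_upwards [ae_restrict_mem measurableSet_Ioi, hne] with u hu huk
    have hcont : Continuous (fun x : ℝ => qmax * (1 - x)) := by fun_prop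
    rcases lt_or_gt_of_ne huk with h | h
    · rw [Set.indicator_of_notMem (by simpa using h.le)]
      have h' := ((key u hu).1).2 h
      refine (hasDerivAt_const α (Cchan B Psi Ups r β u * T / A * Real.exp (-u))).congr_of_eventuallyEq ?_
      filter_upwards [hcont.continuousAt.eventually_const_lt h'] with x hx
      rw [min_eq_left hx.le]
    · rw [Set.indicator_of_mem (by simpa using h)]
      have h' := ((key u hu).2).2 h
      have hd : HasDerivAt (fun x : ℝ => qmax * (1 - x) * Real.exp (-u))
          (-qmax * Real.exp (-u)) α := by
        have := (((hasDerivAt_id α).const_sub 1).const_mul qmax).mul_const (Real.exp (-u))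
        simpa using this
      refine hd.congr_of_eventuallyEq ?_
      filter_upwards [hcont.continuousAt.eventually_lt_const h'] with x hx
      rw [min_eq_right hx.le]
end

section
/- (Lemma 1) Fix x ∈ (0, q_max]. Over the feasible set of cached fractions α ∈ [x/q_max, 1], the objective α ↦ x + G(α) attains its maximum uniquely at α* = x/q_max (equivalently, the optimal cached quality is q* = x/α* = q_max). -/
open Real MeasureTheory

theorem cchan_meas (B Psi Ups r β : ℝ) : Measurable (Cchan B Psi Ups r β) := by
  unfold Cchan Real.logb
  fun_prop

theorem cchan_nonneg (B Psi Ups r β : ℝ) (hB : 0 < B) (hPsi : 0 < Psi) (hUps : 0 < Ups)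
    (hr : 0 < r) (u : ℝ) (hu : 0 < u) : 0 ≤ Cchan B Psi Ups r β u := by
  unfold Cchan
  have h : 0 < Psi * u / (r ^ β * (Ups + 1)) := by positivity
  exact mul_nonneg hB.le (Real.logb_nonneg (by norm_num) (by linarith))

theorem cchan_tendsto (B Psi Ups r β : ℝ) (hB : 0 < B) (hPsi : 0 < Psi) (hUps : 0 < Ups)
    (hr : 0 < r) : Filter.Tendsto (Cchan B Psi Ups r β) Filter.atTop Filter.atTop := by
  unfold Cchan
  have hc : 0 < r ^ β * (Ups + 1) := by positivity
  exact ((Real.tendsto_logb_atTop (by norm_num)).comp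
    (Filter.tendsto_atTop_add_const_left _ 1
      ((Filter.tendsto_id.const_mul_atTop hPsi).atTop_div_const hc))).const_mul_atTop hB

theorem g_integrable (B Psi Ups T A r β c : ℝ)
    (hB : 0 < B) (hPsi : 0 < Psi) (hUps : 0 < Ups) (hT : 0 < T)
    (hA : 0 < A) (hr : 0 < r) (hc : 0 ≤ c) :
    IntegrableOn (fun u => min (Cchan B Psi Ups r β u * T / A) c * Real.exp (-u))
      (Set.Ioi (0 : ℝ)) := by
  have hm := cchan_meas B Psi Ups r β
  refine Integrable.mono' (g := fun u => c * Real.exp (-u))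
    ((integrableOn_exp_neg_Ioi 0).const_mul c) (by
      apply Measurable.aestronglyMeasurable; fun_prop) ?_
  filter_upwards [ae_restrict_mem measurableSet_Ioi] with u hu
  have h0 := cchan_nonneg B Psi Ups r β hB hPsi hUps hr u hu
  rw [Real.norm_of_nonneg (by positivity)]
  exact mul_le_mul_of_nonneg_right (min_le_right _ _) (Real.exp_pos _).le

theorem g_lt (B Psi Ups T A qmax r β : ℝ)
    (hB : 0 < B) (hPsi : 0 < Psi) (hUps : 0 < Ups) (hT : 0 < T)
    (hA : 0 < A) (hq : 0 < qmax) (hr : 0 < r) (a b : ℝ) (hab : a < b) (hb : b ≤ 1) :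
    Gfun B Psi Ups T A qmax r β b < Gfun B Psi Ups T A qmax r β a := by
  have hcb : 0 ≤ qmax * (1 - b) := mul_nonneg hq.le (by linarith)
  have hlt : qmax * (1 - b) < qmax * (1 - a) := mul_lt_mul_of_pos_left (by linarith) hq
  have ib := g_integrable B Psi Ups T A r β _ hB hPsi hUps hT hA hr hcb
  have ia := g_integrable B Psi Ups T A r β _ hB hPsi hUps hT hA hr (hcb.trans hlt.le)
  rw [← sub_pos]
  unfold Gfun
  rw [← integral_sub ia ib]
  refine (setIntegral_pos_iff_support_of_nonneg_ae ?_ (ia.sub ib)).2 ?_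
  rotate_left
  · obtain ⟨K, hK⟩ := Filter.eventually_atTop.1
      (((((cchan_tendsto B Psi Ups r β hB hPsi hUps hr).atTop_mul_const hT).atTop_div_const
        hA)).eventually_gt_atTop (qmax * (1 - b)))
    have hsub : Set.Ioi (max K 0) ⊆ (Function.support fun u =>
        min (Cchan B Psi Ups r β u * T / A) (qmax * (1 - a)) * Real.exp (-u) -
        min (Cchan B Psi Ups r β u * T / A) (qmax * (1 - b)) * Real.exp (-u)) ∩
        Set.Ioi 0 := by
      intro u hu
      obtain ⟨h1, h2⟩ := max_lt_iff.1 (Set.mem_Ioi.1 hu)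
      refine ⟨?_, h2⟩
      have h3 := hK u h1.le
      rw [Function.mem_support, ← sub_mul, min_eq_right h3.le]
      exact (mul_pos (sub_pos.2 (lt_min h3 hlt)) (Real.exp_pos _)).ne'
    refine lt_of_lt_of_le ?_ (measure_mono hsub)
    simp
  · refine Filter.Eventually.of_forall fun u => ?_
    simp only [Pi.zero_apply, Pi.sub_apply]
    rw [← sub_mul]
    exact mul_nonneg (sub_nonneg.2 (min_le_min_left _ hlt.le)) (Real.exp_pos _).le

theorem stmt_5 (B Psi Ups T A qmax r β : ℝ)
    (hB : 0 < B) (hPsi : 0 < Psi) (hUps : 0 < Ups) (hT : 0 < T)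
    (hA : 0 < A) (hq : 0 < qmax) (hr : 0 < r) (hβ : 0 < β)
    (x : ℝ) (hx0 : 0 < x) (hxq : x ≤ qmax) :
    ∀ α ∈ Set.Icc (x / qmax) 1,
      (x + Gfun B Psi Ups T A qmax r β α ≤
        x + Gfun B Psi Ups T A qmax r β (x / qmax)) ∧
      (α ≠ x / qmax →
        x + Gfun B Psi Ups T A qmax r β α <
          x + Gfun B Psi Ups T A qmax r β (x / qmax)) := by
  intro α hα
  have key : α ≠ x / qmax → x + Gfun B Psi Ups T A qmax r β α <
      x + Gfun B Psi Ups T A qmax r β (x / qmax) := fun hne =>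
    add_lt_add_right (g_lt B Psi Ups T A qmax r β hB hPsi hUps hT hA hq hr _ _
      (lt_of_le_of_ne hα.1 (Ne.symm hne)) hα.2) x
  refine ⟨?_, key⟩
  by_cases h : α = x / qmax
  · rw [h]
  · exact (key h).le
end

section
/- (Water-filling optimality) Let f₁ ≥ f₂ ≥ … ≥ f_F > 0 be popularities, let Φ(x) = x + G(x/q_max) on [0, q_max], and let C₀ > 0 be a cache budget with Σᵢ xᵢ ≤ C₀, 0 ≤ xᵢ ≤ q_max. Suppose x* = (x*₁,…,x*_F) is feasible with Σᵢ x*ᵢ = C₀ and there exists μ ≥ 0 such that for every i: fᵢ·(1 − e^{−k(x*ᵢ/q_max)}) = μ whenever 0 < x*ᵢ < q_max, fᵢ·(1 − e^{−k(0)}) ≤ μ whenever x*ᵢ = 0, and fᵢ·(1 − e^{−k(1)}) ≥ μ whenever x*ᵢ = q_max. Then x* maximizes Σᵢ fᵢ·Φ(xᵢ) over all feasible x. -/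
open Real MeasureTheory

lemma aux_int (B Psi Ups T A qmax r β : ℝ)
    (hB : 0 < B) (hPsi : 0 < Psi) (hUps : 0 < Ups) (hT : 0 < T)
    (hA : 0 < A) (hq : 0 < qmax) (hr : 0 < r) (a : ℝ) (ha : a ≤ 1) :
    IntegrableOn (fun u => min (Cchan B Psi Ups r β u * T / A) (qmax * (1 - a)) * Real.exp (-u))
      (Set.Ioi (0 : ℝ)) := by
  have hE : IntegrableOn (fun u : ℝ => (qmax * (1 - a)) * Real.exp (-u)) (Set.Ioi (0 : ℝ)) :=
    (integrableOn_exp_neg_Ioi 0).const_mul _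
  have hm : 0 ≤ qmax * (1 - a) := mul_nonneg hq.le (by linarith)
  refine Integrable.mono' hE ?_ ?_
  · apply Measurable.aestronglyMeasurable
    unfold Cchan Real.logb
    fun_prop
  · refine (ae_restrict_iff' measurableSet_Ioi).2 (Filter.Eventually.of_forall fun u hu => ?_)
    have hu : 0 < u := hu
    have hD : 0 < r ^ β * (Ups + 1) := mul_pos (Real.rpow_pos_of_pos hr _) (by linarith)
    have hc : 0 ≤ Cchan B Psi Ups r β u * T / A := by
      have h1 : 0 ≤ Real.logb 2 (1 + Psi * u / (r ^ β * (Ups + 1))) := by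
        apply Real.logb_nonneg (by norm_num)
        have : 0 ≤ Psi * u / (r ^ β * (Ups + 1)) := by positivity
        linarith
      unfold Cchan
      positivity
    rw [Real.norm_eq_abs, abs_of_nonneg (mul_nonneg (le_min hc hm) (Real.exp_pos _).le)]
    exact mul_le_mul_of_nonneg_right (min_le_right _ _) (Real.exp_pos _).le

lemma aux_thr (B Psi Ups T A qmax r β : ℝ)
    (hB : 0 < B) (hPsi : 0 < Psi) (hUps : 0 < Ups) (hT : 0 < T)
    (hA : 0 < A) (hr : 0 < r) (b u : ℝ) (hu : 0 < u) :
    qmax * (1 - b) ≤ Cchan B Psi Ups r β u * T / A ↔ kThr B Psi Ups T A qmax r β b ≤ u := by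
  have hD : 0 < r ^ β := Real.rpow_pos_of_pos hr _
  have hU : 0 < Ups + 1 := by linarith
  have hp : 0 < 1 + Psi * u / (r ^ β * (Ups + 1)) := by positivity
  have h1 : qmax * (1 - b) ≤ Cchan B Psi Ups r β u * T / A ↔
      A * qmax * (1 - b) / (T * B) ≤ Real.logb 2 (1 + Psi * u / (r ^ β * (Ups + 1))) := by
    unfold Cchan
    rw [le_div_iff₀ hA, div_le_iff₀ (by positivity)]
    constructor <;> intro h <;> linarith
  rw [h1, Real.le_logb_iff_rpow_le (by norm_num) hp]
  unfold kThr
  generalize (2 : ℝ) ^ (A * qmax * (1 - b) / (T * B)) = z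
  rw [← sub_le_iff_le_add', le_div_iff₀ (by positivity)]
  have : r ^ β * ((Ups + 1) / Psi) * (z - 1) = ((z - 1) * (r ^ β * (Ups + 1))) / Psi := by
    field_simp
  rw [this, div_le_iff₀ hPsi, mul_comm u]

lemma aux_G (B Psi Ups T A qmax r β : ℝ)
    (hB : 0 < B) (hPsi : 0 < Psi) (hUps : 0 < Ups) (hT : 0 < T)
    (hA : 0 < A) (hq : 0 < qmax) (hr : 0 < r) (a b : ℝ) (ha : a ≤ 1) (hb : b ≤ 1) :
    Gfun B Psi Ups T A qmax r β a ≤ Gfun B Psi Ups T A qmax r β b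
      - qmax * (a - b) * Real.exp (-(kThr B Psi Ups T A qmax r β b)) := by
  have hk : 0 ≤ kThr B Psi Ups T A qmax r β b := by
    unfold kThr
    have h1 : (1 : ℝ) ≤ (2 : ℝ) ^ (A * qmax * (1 - b) / (T * B)) := by
      apply Real.one_le_rpow (by norm_num)
      have : 0 ≤ 1 - b := by linarith
      positivity
    have hD : 0 < r ^ β := Real.rpow_pos_of_pos hr _
    have : 0 ≤ (2 : ℝ) ^ (A * qmax * (1 - b) / (T * B)) - 1 := by linarith
    positivity
  have hthr := aux_thr B Psi Ups T A qmax r β hB hPsi hUps hT hA hr b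
  set k := kThr B Psi Ups T A qmax r β b with hkdef
  have hIa := aux_int B Psi Ups T A qmax r β hB hPsi hUps hT hA hq hr a ha
  have hIb := aux_int B Psi Ups T A qmax r β hB hPsi hUps hT hA hq hr b hb
  have hI0 : Integrable ((Set.Ici k).indicator (fun u : ℝ => Real.exp (-u)))
      (volume.restrict (Set.Ioi (0 : ℝ))) :=
    Integrable.indicator (integrableOn_exp_neg_Ioi 0) measurableSet_Ici
  have hIe := hI0.const_mul (qmax * (a - b))
  have hval : ∫ u in Set.Ioi (0 : ℝ), (Set.Ici k).indicator (fun u : ℝ => Real.exp (-u)) u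
      = Real.exp (-k) := by
    rw [integral_indicator measurableSet_Ici, Measure.restrict_restrict measurableSet_Ici,
      ← integral_exp_neg_Ioi k]
    refine setIntegral_congr_set ?_
    have h1 : (Set.Ici k ∩ Set.Ioi (0 : ℝ) : Set ℝ) =ᵐ[volume] (Set.Ioi k ∩ Set.Ioi 0 : Set ℝ) :=
      Ioi_ae_eq_Ici.symm.inter (Filter.EventuallyEq.refl _ _)
    rwa [Set.inter_eq_left.2 (Set.Ioi_subset_Ioi hk)] at h1
  unfold Gfun
  rw [← hval, ← integral_const_mul, ← integral_sub hIb hIe]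
  refine setIntegral_mono_on hIa (hIb.sub hIe) measurableSet_Ioi fun u hu => ?_
  have ht := hthr u hu
  have he := (Real.exp_pos (-u)).le
  by_cases h : k ≤ u
  · rw [Set.indicator_of_mem (show u ∈ Set.Ici k from h), min_eq_right (ht.2 h), ← sub_mul]
    refine mul_le_mul_of_nonneg_right ((min_le_right _ _).trans (by linarith)) he
  · rw [Set.indicator_of_notMem (show u ∉ Set.Ici k from h), mul_zero, sub_zero]
    refine mul_le_mul_of_nonneg_right ?_ he
    have hle : Cchan B Psi Ups r β u * T / A ≤ qmax * (1 - b) := by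
      exact (not_le.1 fun h2 => h (ht.1 h2)).le
    rw [min_eq_left hle]
    exact min_le_left _ _

theorem stmt_11 (B Psi Ups T A qmax r β : ℝ)
    (hB : 0 < B) (hPsi : 0 < Psi) (hUps : 0 < Ups) (hT : 0 < T)
    (hA : 0 < A) (hq : 0 < qmax) (hr : 0 < r) (hβ : 0 < β)
    (F : ℕ) (f : Fin F → ℝ)
    (hfpos : ∀ i, 0 < f i)
    (hfdec : ∀ i j : Fin F, i ≤ j → f j ≤ f i)
    (C₀ : ℝ) (hC₀ : 0 < C₀)
    (xstar : Fin F → ℝ)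
    (hfeas : ∀ i, 0 ≤ xstar i ∧ xstar i ≤ qmax)
    (hbudget : ∑ i, xstar i = C₀)
    (μ : ℝ) (hμ : 0 ≤ μ)
    (hactive : ∀ i, 0 < xstar i → xstar i < qmax →
      f i * (1 - Real.exp (-(kThr B Psi Ups T A qmax r β (xstar i / qmax)))) = μ)
    (hzero : ∀ i, xstar i = 0 →
      f i * (1 - Real.exp (-(kThr B Psi Ups T A qmax r β 0))) ≤ μ)
    (hfull : ∀ i, xstar i = qmax →
      μ ≤ f i * (1 - Real.exp (-(kThr B Psi Ups T A qmax r β 1)))) :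
    ∀ x : Fin F → ℝ, (∀ i, 0 ≤ x i ∧ x i ≤ qmax) → (∑ i, x i) ≤ C₀ →
      ∑ i, f i * (x i + Gfun B Psi Ups T A qmax r β (x i / qmax)) ≤
        ∑ i, f i * (xstar i + Gfun B Psi Ups T A qmax r β (xstar i / qmax)) := by
  intro x hx hxs
  have key : ∀ i, f i * (x i + Gfun B Psi Ups T A qmax r β (x i / qmax)) ≤
      f i * (xstar i + Gfun B Psi Ups T A qmax r β (xstar i / qmax)) + μ * (x i - xstar i) := by
    intro i
    obtain ⟨hx0, hx1⟩ := hx i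
    obtain ⟨hs0, hs1⟩ := hfeas i
    have hG := aux_G B Psi Ups T A qmax r β hB hPsi hUps hT hA hq hr (x i / qmax) (xstar i / qmax)
      ((div_le_one hq).2 hx1) ((div_le_one hq).2 hs1)
    have e1 : qmax * (x i / qmax - xstar i / qmax) = x i - xstar i := by field_simp
    rw [e1] at hG
    have h2 := mul_le_mul_of_nonneg_left hG (hfpos i).le
    have h3 : f i * (1 - Real.exp (-(kThr B Psi Ups T A qmax r β (xstar i / qmax))))
        * (x i - xstar i) ≤ μ * (x i - xstar i) := by
      rcases hs0.eq_or_lt with h | h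
      · have hz := hzero i h.symm
        rw [← h, zero_div]
        exact mul_le_mul_of_nonneg_right hz (by linarith)
      · rcases hs1.eq_or_lt with h' | h'
        · have hz := hfull i h'
          rw [h', div_self hq.ne']
          exact mul_le_mul_of_nonpos_right hz (by linarith)
        · rw [hactive i h h']
    linarith
  have h := Finset.sum_le_sum fun i (_ : i ∈ Finset.univ) => key i
  rw [Finset.sum_add_distrib, ← Finset.mul_sum, Finset.sum_sub_distrib, hbudget] at h
  have : μ * (∑ i, x i - C₀) ≤ 0 := mul_nonpos_of_nonneg_of_nonpos hμ (by linarith)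
  linarith
end

section
/- (Lemma 2, monotonicity part) The averaged expected delivered quality H(α) = ∫₀^R [∫₀^∞ min{C(u,r)·T/A, q_max·(1−α)}·e^{−u} du]·(2r/R²) dr is strictly decreasing on [0,1]; moreover, for α ∈ (0,1) it is differentiable with H′(α) = −q_max·∫₀^R e^{−l(α)·r^β}·(2r/R²) dr < 0. -/
open Real MeasureTheory

/-- Channel capacity `C(u, r) = B·log₂(1 + Ψ·u/(r^β·(Υ+1)))`. -/
noncomputable def Cchan2 (B Psi Ups β : ℝ) (u r : ℝ) : ℝ :=
  B * Real.logb 2 (1 + Psi * u / (r ^ β * (Ups + 1)))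

/-- Threshold `l(α) = ((Υ+1)/Ψ)·(2^{A·q_max·(1−α)/(T·B)} − 1)`. -/
noncomputable def lThr (B Psi Ups T A qmax : ℝ) (α : ℝ) : ℝ :=
  ((Ups + 1) / Psi) * ((2 : ℝ) ^ (A * qmax * (1 - α) / (T * B)) - 1)

/-- Averaged expected delivered quality
`H(α) = ∫₀^R [∫₀^∞ min{C(u,r)·T/A, q_max·(1−α)}·e^{−u} du]·(2r/R²) dr`. -/
noncomputable def Hfun (B Psi Ups T A qmax R β : ℝ) (α : ℝ) : ℝ :=
  ∫ r in (0 : ℝ)..R,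
    (∫ u in Set.Ioi (0 : ℝ),
      min (Cchan2 B Psi Ups β u r * T / A) (qmax * (1 - α)) * Real.exp (-u)) *
    (2 * r / R ^ 2)

noncomputable def Gin (B Psi Ups T A qmax β : ℝ) (α r : ℝ) : ℝ :=
  ∫ u in Set.Ioi (0 : ℝ),
      min (Cchan2 B Psi Ups β u r * T / A) (qmax * (1 - α)) * Real.exp (-u)

lemma cap_lt_iff (B Psi Ups T A qmax β : ℝ)
    (hB : 0 < B) (hPsi : 0 < Psi) (hUps : 0 < Ups) (hT : 0 < T)
    (hA : 0 < A) (α u r : ℝ) (hu : 0 < u) (hr : 0 < r) :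
    Cchan2 B Psi Ups β u r * T / A < qmax * (1 - α) ↔
      u < lThr B Psi Ups T A qmax α * r ^ β := by
  have hrb : 0 < r ^ β := Real.rpow_pos_of_pos hr β
  have hx : 0 < 1 + Psi * u / (r ^ β * (Ups + 1)) := by positivity
  unfold Cchan2 lThr
  have e1 : B * Real.logb 2 (1 + Psi * u / (r ^ β * (Ups + 1))) * T / A < qmax * (1 - α) ↔
      Real.logb 2 (1 + Psi * u / (r ^ β * (Ups + 1))) < A * qmax * (1 - α) / (T * B) := by
    rw [div_lt_iff₀ hA, lt_div_iff₀ (by positivity)]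
    constructor <;> intro h <;> nlinarith
  rw [e1, Real.logb_lt_iff_lt_rpow (by norm_num) hx]
  generalize (2 : ℝ) ^ (A * qmax * (1 - α) / (T * B)) = y
  rw [← lt_sub_iff_add_lt', div_lt_iff₀ (by positivity)]
  have e2 : (Ups + 1) / Psi * (y - 1) * r ^ β = ((y - 1) * (r ^ β * (Ups + 1))) / Psi := by
    field_simp
  rw [e2, lt_div_iff₀ hPsi, mul_comm u]

lemma lt_cap_iff (B Psi Ups T A qmax β : ℝ)
    (hB : 0 < B) (hPsi : 0 < Psi) (hUps : 0 < Ups) (hT : 0 < T)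
    (hA : 0 < A) (α u r : ℝ) (hu : 0 < u) (hr : 0 < r) :
    qmax * (1 - α) < Cchan2 B Psi Ups β u r * T / A ↔
      lThr B Psi Ups T A qmax α * r ^ β < u := by
  have hrb : 0 < r ^ β := Real.rpow_pos_of_pos hr β
  have hx : 0 < 1 + Psi * u / (r ^ β * (Ups + 1)) := by positivity
  unfold Cchan2 lThr
  have e1 : qmax * (1 - α) < B * Real.logb 2 (1 + Psi * u / (r ^ β * (Ups + 1))) * T / A ↔
      A * qmax * (1 - α) / (T * B) < Real.logb 2 (1 + Psi * u / (r ^ β * (Ups + 1))) := by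
    rw [lt_div_iff₀ hA, div_lt_iff₀ (by positivity)]
    constructor <;> intro h <;> nlinarith
  rw [e1, Real.lt_logb_iff_rpow_lt (by norm_num) hx]
  generalize (2 : ℝ) ^ (A * qmax * (1 - α) / (T * B)) = y
  rw [← sub_lt_iff_lt_add', lt_div_iff₀ (by positivity)]
  have e2 : (Ups + 1) / Psi * (y - 1) * r ^ β = ((y - 1) * (r ^ β * (Ups + 1))) / Psi := by
    field_simp
  rw [e2, div_lt_iff₀ hPsi, mul_comm u]

lemma cap_nonneg (B Psi Ups T A β : ℝ)
    (hB : 0 < B) (hPsi : 0 < Psi) (hUps : 0 < Ups) (hT : 0 < T)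
    (hA : 0 < A) (u r : ℝ) (hu : 0 < u) (hr : 0 < r) :
    0 ≤ Cchan2 B Psi Ups β u r * T / A := by
  have hrb : 0 < r ^ β := Real.rpow_pos_of_pos hr β
  have : 0 ≤ Real.logb 2 (1 + Psi * u / (r ^ β * (Ups + 1))) :=
    Real.logb_nonneg (by norm_num) (le_add_of_nonneg_right (by positivity))
  unfold Cchan2
  positivity

lemma meas_all (B Psi Ups T A qmax β α : ℝ) :
    Measurable (Function.uncurry fun r u : ℝ =>
      min (Cchan2 B Psi Ups β u r * T / A) (qmax * (1 - α)) * Real.exp (-u)) := by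
  unfold Cchan2 Real.logb Function.uncurry
  fun_prop

lemma min_bound {c m : ℝ} (hc : 0 ≤ c) : |min c m| ≤ |m| := by
  rcases le_total c m with h | h
  · rw [min_eq_left h, abs_of_nonneg hc]; exact h.trans (le_abs_self m)
  · rw [min_eq_right h]

lemma integrable_in (B Psi Ups T A qmax β : ℝ)
    (hB : 0 < B) (hPsi : 0 < Psi) (hUps : 0 < Ups) (hT : 0 < T)
    (hA : 0 < A) (α r : ℝ) (hr : 0 < r) :
    Integrable (fun u => min (Cchan2 B Psi Ups β u r * T / A) (qmax * (1 - α)) * Real.exp (-u))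
      (volume.restrict (Set.Ioi (0:ℝ))) := by
  refine Integrable.mono' ((integrableOn_exp_neg_Ioi 0).const_mul |qmax * (1 - α)|)
    ((meas_all B Psi Ups T A qmax β α).of_uncurry_left (x := r)).aestronglyMeasurable ?_
  filter_upwards [ae_restrict_mem measurableSet_Ioi] with u hu
  rw [Real.norm_eq_abs, abs_mul, abs_of_pos (Real.exp_pos _)]
  exact mul_le_mul_of_nonneg_right
    (min_bound (cap_nonneg B Psi Ups T A β hB hPsi hUps hT hA u r hu hr)) (Real.exp_pos _).le

lemma lip_pt (c q e x y : ℝ) (hq : 0 < q) (he : 0 ≤ e) :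
    |min c (q * (1 - x)) * e - min c (q * (1 - y)) * e| ≤ q * e * |x - y| := by
  rw [← sub_mul, abs_mul, abs_of_nonneg he]
  have h := abs_min_sub_min_le_max c (q * (1 - x)) c (q * (1 - y))
  have h2 : |q * (1 - x) - q * (1 - y)| = q * |x - y| := by
    rw [← mul_sub, abs_mul, abs_of_pos hq, abs_sub_comm x y]; congr 2; ring
  rw [sub_self, abs_zero, h2, max_eq_right (by positivity)] at h
  nlinarith

lemma Gin_lip (B Psi Ups T A qmax β : ℝ)
    (hB : 0 < B) (hPsi : 0 < Psi) (hUps : 0 < Ups) (hT : 0 < T)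
    (hA : 0 < A) (hq : 0 < qmax) (x y r : ℝ) (hr : 0 < r) :
    |Gin B Psi Ups T A qmax β x r - Gin B Psi Ups T A qmax β y r| ≤ qmax * |x - y| := by
  unfold Gin
  rw [← integral_sub (integrable_in B Psi Ups T A qmax β hB hPsi hUps hT hA x r hr)
    (integrable_in B Psi Ups T A qmax β hB hPsi hUps hT hA y r hr), ← Real.norm_eq_abs]
  have h := norm_integral_le_of_norm_le (μ := volume.restrict (Set.Ioi (0:ℝ)))
    (f := fun u => min (Cchan2 B Psi Ups β u r * T / A) (qmax * (1 - x)) * Real.exp (-u) -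
      min (Cchan2 B Psi Ups β u r * T / A) (qmax * (1 - y)) * Real.exp (-u))
    (g := fun u => qmax * |x - y| * Real.exp (-u))
    ((integrableOn_exp_neg_Ioi 0).const_mul _) (Filter.Eventually.of_forall fun u => by
      rw [Real.norm_eq_abs]
      refine (lip_pt _ _ _ _ _ hq (Real.exp_pos _).le).trans_eq (by ring))
  rwa [integral_const_mul, integral_exp_neg_Ioi_zero, mul_one] at h

lemma Gin_deriv (B Psi Ups T A qmax β : ℝ)
    (hB : 0 < B) (hPsi : 0 < Psi) (hUps : 0 < Ups) (hT : 0 < T)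
    (hA : 0 < A) (hq : 0 < qmax) (α r : ℝ) (hr : 0 < r)
    (hl : 0 ≤ lThr B Psi Ups T A qmax α) :
    HasDerivAt (fun α => Gin B Psi Ups T A qmax β α r)
      (-(qmax * Real.exp (-(lThr B Psi Ups T A qmax α * r ^ β)))) α := by
  set t := lThr B Psi Ups T A qmax α * r ^ β with ht
  have ht0 : 0 ≤ t := mul_nonneg hl (Real.rpow_nonneg hr.le β)
  have key := hasDerivAt_integral_of_dominated_loc_of_lip
    (μ := volume.restrict (Set.Ioi (0:ℝ))) (x₀ := α) (s := Set.univ)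
    (F := fun α u => min (Cchan2 B Psi Ups β u r * T / A) (qmax * (1 - α)) * Real.exp (-u))
    (F' := (Set.Ioi t).indicator fun u => -qmax * Real.exp (-u))
    (bound := fun u => qmax * Real.exp (-u)) Filter.univ_mem
    (Filter.Eventually.of_forall fun x =>
      (integrable_in B Psi Ups T A qmax β hB hPsi hUps hT hA x r hr).aestronglyMeasurable)
    (integrable_in B Psi Ups T A qmax β hB hPsi hUps hT hA α r hr)
    ((Measurable.indicator (by fun_prop) measurableSet_Ioi).aestronglyMeasurable)
    (Filter.Eventually.of_forall fun u => by
      apply LipschitzOnWith.of_dist_le_mul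
      intro x _ y _
      rw [Real.dist_eq, Real.dist_eq, Real.coe_nnabs,
        abs_of_pos (show 0 < qmax * Real.exp (-u) by positivity)]
      exact lip_pt _ _ _ _ _ hq (Real.exp_pos _).le)
    ((integrableOn_exp_neg_Ioi 0).const_mul _)
    (by
      have hne : ∀ᵐ u ∂(volume.restrict (Set.Ioi (0:ℝ))), u ≠ t :=
        ae_restrict_of_ae (Measure.ae_ne volume t)
      filter_upwards [ae_restrict_mem measurableSet_Ioi, hne] with u hu hut
      have hcont : ContinuousAt (fun x : ℝ => qmax * (1 - x)) α := by fun_prop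
      rcases lt_or_gt_of_ne hut with h | h
      · rw [Set.indicator_of_notMem (by simpa using h.le)]
        have h1 := (cap_lt_iff B Psi Ups T A qmax β hB hPsi hUps hT hA α u r hu hr).2 h
        refine (hasDerivAt_const α (Cchan2 B Psi Ups β u r * T / A * Real.exp (-u))).congr_of_eventuallyEq ?_
        filter_upwards [hcont.eventually (lt_mem_nhds h1)] with x hx
        rw [min_eq_left hx.le]
      · rw [Set.indicator_of_mem (by simpa using h)]
        have h1 := (lt_cap_iff B Psi Ups T A qmax β hB hPsi hUps hT hA α u r hu hr).2 h
        have hd : HasDerivAt (fun x : ℝ => qmax * (1 - x) * Real.exp (-u)) (-qmax * Real.exp (-u)) α := by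
          have := ((((hasDerivAt_id α).const_sub 1).const_mul qmax).mul_const (Real.exp (-u)))
          simpa using this
        refine hd.congr_of_eventuallyEq ?_
        filter_upwards [hcont.eventually (gt_mem_nhds h1)] with x hx
        rw [min_eq_right hx.le])
  have e : ∫ u in Set.Ioi (0:ℝ), (Set.Ioi t).indicator (fun u => -qmax * Real.exp (-u)) u
      = -(qmax * Real.exp (-t)) := by
    rw [setIntegral_indicator measurableSet_Ioi, Set.Ioi_inter_Ioi, sup_eq_right.2 ht0,
      integral_const_mul, integral_exp_neg_Ioi]
    ring
  have k2 := key.2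
  rw [e] at k2
  exact k2

lemma Gin_bound (B Psi Ups T A qmax β : ℝ)
    (hB : 0 < B) (hPsi : 0 < Psi) (hUps : 0 < Ups) (hT : 0 < T)
    (hA : 0 < A) (α r : ℝ) (hr : 0 < r) :
    |Gin B Psi Ups T A qmax β α r| ≤ |qmax * (1 - α)| := by
  unfold Gin
  rw [← Real.norm_eq_abs]
  have h := norm_integral_le_of_norm_le (μ := volume.restrict (Set.Ioi (0:ℝ)))
    (f := fun u => min (Cchan2 B Psi Ups β u r * T / A) (qmax * (1 - α)) * Real.exp (-u))
    (g := fun u => |qmax * (1 - α)| * Real.exp (-u))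
    ((integrableOn_exp_neg_Ioi 0).const_mul _) (by
      filter_upwards [ae_restrict_mem measurableSet_Ioi] with u hu
      rw [Real.norm_eq_abs, abs_mul, abs_of_pos (Real.exp_pos _)]
      exact mul_le_mul_of_nonneg_right
        (min_bound (cap_nonneg B Psi Ups T A β hB hPsi hUps hT hA u r hu hr)) (Real.exp_pos _).le)
  rwa [integral_const_mul, integral_exp_neg_Ioi_zero, mul_one] at h

lemma Gin_meas (B Psi Ups T A qmax β α : ℝ) :
    StronglyMeasurable (fun r => Gin B Psi Ups T A qmax β α r) :=
  (meas_all B Psi Ups T A qmax β α).stronglyMeasurable.integral_prod_right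

lemma H_deriv (B Psi Ups T A qmax R β : ℝ)
    (hB : 0 < B) (hPsi : 0 < Psi) (hUps : 0 < Ups) (hT : 0 < T)
    (hA : 0 < A) (hq : 0 < qmax) (hR : 0 < R) (α : ℝ)
    (hα : α ≤ 1) :
    HasDerivAt (Hfun B Psi Ups T A qmax R β)
        (-(qmax * ∫ r in (0 : ℝ)..R,
            Real.exp (-(lThr B Psi Ups T A qmax α * r ^ β)) * (2 * r / R ^ 2))) α := by
  have hl : 0 ≤ lThr B Psi Ups T A qmax α := by
    unfold lThr
    have h0 : 0 ≤ A * qmax * (1 - α) / (T * B) := by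
      have : 0 ≤ 1 - α := by linarith
      positivity
    have h1 : (1:ℝ) ≤ 2 ^ (A * qmax * (1 - α) / (T * B)) :=
      Real.one_le_rpow (by norm_num) h0
    have : 0 ≤ (2:ℝ) ^ (A * qmax * (1 - α) / (T * B)) - 1 := by linarith
    positivity
  have hmeas : ∀ x, Measurable (fun r => Gin B Psi Ups T A qmax β x r * (2 * r / R ^ 2)) :=
    fun x => (Gin_meas B Psi Ups T A qmax β x).measurable.mul (by fun_prop)
  have hw : Continuous (fun r : ℝ => 2 * r / R ^ 2) := by fun_prop
  have key := intervalIntegral.hasDerivAt_integral_of_dominated_loc_of_lip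
    (μ := volume) (a := 0) (b := R) (x₀ := α) (s := Set.univ)
    (F := fun α r => Gin B Psi Ups T A qmax β α r * (2 * r / R ^ 2))
    (F' := fun r => -qmax * (Real.exp (-(lThr B Psi Ups T A qmax α * r ^ β)) * (2 * r / R ^ 2)))
    (bound := fun r => qmax * (2 * r / R ^ 2)) Filter.univ_mem
    (Filter.Eventually.of_forall fun x => (hmeas x).aestronglyMeasurable)
    (by
      refine IntervalIntegrable.mono_fun'
        (g := fun r => |qmax * (1 - α)| * (2 * r / R ^ 2))
        ((hw.intervalIntegrable 0 R).const_mul _) (hmeas α).aestronglyMeasurable ?_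
      filter_upwards [ae_restrict_mem measurableSet_uIoc] with r hr
      rw [Set.uIoc_of_le hR.le] at hr
      have hr0 := hr.1
      have hp : 0 < 2 * r / R ^ 2 := by positivity
      rw [Real.norm_eq_abs, abs_mul, abs_of_pos hp]
      exact mul_le_mul_of_nonneg_right
        (Gin_bound B Psi Ups T A qmax β hB hPsi hUps hT hA α r hr0) hp.le)
    (Measurable.aestronglyMeasurable (by fun_prop))
    (Filter.Eventually.of_forall fun r hr => by
      rw [Set.uIoc_of_le hR.le] at hr
      have hr0 := hr.1
      have hp : 0 < 2 * r / R ^ 2 := by positivity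
      apply LipschitzOnWith.of_dist_le_mul
      intro x _ y _
      rw [Real.dist_eq, Real.dist_eq, Real.coe_nnabs,
        abs_of_pos (show 0 < qmax * (2 * r / R ^ 2) by positivity), ← sub_mul,
        abs_mul, abs_of_pos hp]
      have := Gin_lip B Psi Ups T A qmax β hB hPsi hUps hT hA hq x y r hr0
      nlinarith)
    ((hw.intervalIntegrable 0 R).const_mul _)
    (Filter.Eventually.of_forall fun r hr => by
      rw [Set.uIoc_of_le hR.le] at hr
      have := (Gin_deriv B Psi Ups T A qmax β hB hPsi hUps hT hA hq α r hr.1 hl).mul_const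
        (2 * r / R ^ 2)
      refine this.congr_deriv (by ring))
  have k2 := key.2
  rw [intervalIntegral.integral_const_mul, neg_mul] at k2
  exact k2

lemma H_neg (B Psi Ups T A qmax R β : ℝ)
    (hq : 0 < qmax) (hR : 0 < R) (hβ : 0 < β) (α : ℝ) :
    -(qmax * ∫ r in (0 : ℝ)..R,
            Real.exp (-(lThr B Psi Ups T A qmax α * r ^ β)) * (2 * r / R ^ 2)) < 0 := by
  have hc : Continuous (fun r : ℝ =>
      Real.exp (-(lThr B Psi Ups T A qmax α * r ^ β)) * (2 * r / R ^ 2)) := by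
    have := Real.continuous_rpow_const hβ.le
    fun_prop
  have := intervalIntegral.intervalIntegral_pos_of_pos_on (hc.intervalIntegrable 0 R)
    (fun r hr => by
      have := hr.1
      positivity) hR
  have := mul_pos hq this
  linarith

theorem stmt_13 (B Psi Ups T A qmax R β : ℝ)
    (hB : 0 < B) (hPsi : 0 < Psi) (hUps : 0 < Ups) (hT : 0 < T)
    (hA : 0 < A) (hq : 0 < qmax) (hR : 0 < R) (hβ : 0 < β) :
    StrictAntiOn (Hfun B Psi Ups T A qmax R β) (Set.Icc 0 1) ∧
    (∀ α ∈ Set.Ioo (0 : ℝ) 1,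
      HasDerivAt (Hfun B Psi Ups T A qmax R β)
        (-(qmax * ∫ r in (0 : ℝ)..R,
            Real.exp (-(lThr B Psi Ups T A qmax α * r ^ β)) * (2 * r / R ^ 2))) α ∧
      -(qmax * ∫ r in (0 : ℝ)..R,
          Real.exp (-(lThr B Psi Ups T A qmax α * r ^ β)) * (2 * r / R ^ 2)) < 0) := by
  refine ⟨?_, fun α hα => ⟨H_deriv B Psi Ups T A qmax R β hB hPsi hUps hT hA hq hR α hα.2.le,
    H_neg B Psi Ups T A qmax R β hq hR hβ α⟩⟩
  refine strictAntiOn_of_deriv_neg (convex_Icc 0 1) (fun x hx =>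
    (H_deriv B Psi Ups T A qmax R β hB hPsi hUps hT hA hq hR x
      hx.2).continuousAt.continuousWithinAt) (fun x hx => ?_)
  rw [interior_Icc] at hx
  rw [(H_deriv B Psi Ups T A qmax R β hB hPsi hUps hT hA hq hR x hx.2.le).deriv]
  exact H_neg B Psi Ups T A qmax R β hq hR hβ x
end

section
/- (Lemma 2) Fix x ∈ (0, q_max]. Over the feasible set α ∈ [x/q_max, 1], the objective α ↦ x + H(α) attains its maximum uniquely at α* = x/q_max (equivalently, the optimal cached quality is q* = x/α* = q_max). -/
open Real MeasureTheory

lemma Cmeas (B Psi Ups T A β c : ℝ) :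
    Measurable (fun p : ℝ × ℝ =>
      min (Cchan2 B Psi Ups β p.2 p.1 * T / A) c * Real.exp (-p.2)) := by
  unfold Cchan2 Real.logb
  fun_prop

lemma Cnonneg (B Psi Ups β u r : ℝ) (hB : 0 < B) (hPsi : 0 < Psi) (hUps : 0 < Ups)
    (hu : 0 < u) (hr : 0 < r) : 0 ≤ Cchan2 B Psi Ups β u r := by
  unfold Cchan2
  refine mul_nonneg hB.le (Real.logb_nonneg (by norm_num) ?_)
  have : 0 ≤ Psi * u / (r ^ β * (Ups + 1)) := by positivity
  linarith

lemma innerBound (B Psi Ups T A β c u r : ℝ) (hB : 0 < B) (hPsi : 0 < Psi) (hUps : 0 < Ups)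
    (hT : 0 < T) (hA : 0 < A) (hc : 0 ≤ c) (hu : 0 < u) (hr : 0 < r) :
    ‖min (Cchan2 B Psi Ups β u r * T / A) c * Real.exp (-u)‖ ≤ c * Real.exp (-u) := by
  have h := Cnonneg B Psi Ups β u r hB hPsi hUps hu hr
  have h0 : 0 ≤ min (Cchan2 B Psi Ups β u r * T / A) c := le_min (by positivity) hc
  rw [Real.norm_of_nonneg (by positivity)]
  gcongr
  exact min_le_right _ _

lemma expInt (c : ℝ) : IntegrableOn (fun u : ℝ => c * Real.exp (-u)) (Set.Ioi 0) :=
  (integrableOn_exp_neg_Ioi 0).const_mul c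

lemma innerInt (B Psi Ups T A β c r : ℝ) (hB : 0 < B) (hPsi : 0 < Psi) (hUps : 0 < Ups)
    (hT : 0 < T) (hA : 0 < A) (hc : 0 ≤ c) (hr : 0 < r) :
    IntegrableOn (fun u => min (Cchan2 B Psi Ups β u r * T / A) c * Real.exp (-u))
      (Set.Ioi 0) := by
  refine (expInt c).mono' ?_ ?_
  · exact ((Cmeas B Psi Ups T A β c).comp (measurable_const.prodMk measurable_id)
      : Measurable (fun u : ℝ => _)).aestronglyMeasurable
  · filter_upwards [ae_restrict_mem measurableSet_Ioi] with u hu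
    exact innerBound B Psi Ups T A β c u r hB hPsi hUps hT hA hc hu hr

lemma outerInt (B Psi Ups T A R β c : ℝ) (hB : 0 < B) (hPsi : 0 < Psi) (hUps : 0 < Ups)
    (hT : 0 < T) (hA : 0 < A) (hR : 0 < R) (hc : 0 ≤ c) :
    IntervalIntegrable (fun r => (∫ u in Set.Ioi (0 : ℝ),
      min (Cchan2 B Psi Ups β u r * T / A) c * Real.exp (-u)) * (2 * r / R ^ 2))
      volume 0 R := by
  rw [intervalIntegrable_iff_integrableOn_Ioc_of_le hR.le]
  have hm : StronglyMeasurable (fun r => ∫ u in Set.Ioi (0 : ℝ),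
      min (Cchan2 B Psi Ups β u r * T / A) c * Real.exp (-u)) :=
    (Cmeas B Psi Ups T A β c).stronglyMeasurable.integral_prod_right
  refine Integrable.mono' (g := fun _ => c * (2 * R / R ^ 2)) ?_ ?_ ?_
  · exact integrableOn_const (by simp)
  · exact (hm.mul (by fun_prop : Measurable fun r : ℝ =>
      2 * r / R ^ 2).stronglyMeasurable).aestronglyMeasurable
  · filter_upwards [ae_restrict_mem measurableSet_Ioc] with r hr
    rw [norm_mul]
    have h1 : ‖∫ u in Set.Ioi (0 : ℝ),
        min (Cchan2 B Psi Ups β u r * T / A) c * Real.exp (-u)‖ ≤ c := by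
      have h2 := norm_integral_le_of_norm_le (μ := volume.restrict (Set.Ioi (0:ℝ)))
        (f := fun u => min (Cchan2 B Psi Ups β u r * T / A) c * Real.exp (-u))
        (expInt c) (by
          filter_upwards [ae_restrict_mem measurableSet_Ioi] with u hu
          exact innerBound B Psi Ups T A β c u r hB hPsi hUps hT hA hc hu hr.1)
      refine h2.trans_eq ?_
      rw [integral_const_mul, integral_exp_neg_Ioi_zero, mul_one]
    have hr0 := hr.1
    have h3 : ‖2 * r / R ^ 2‖ ≤ 2 * R / R ^ 2 := by
      rw [Real.norm_of_nonneg (by positivity)]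
      have := hr.2
      gcongr
    exact mul_le_mul h1 h3 (norm_nonneg _) hc

lemma Ctends (B Psi Ups T A β r : ℝ) (hB : 0 < B) (hPsi : 0 < Psi) (hUps : 0 < Ups)
    (hT : 0 < T) (hA : 0 < A) (hr : 0 < r) :
    Filter.Tendsto (fun u => Cchan2 B Psi Ups β u r * T / A) Filter.atTop Filter.atTop := by
  unfold Cchan2
  refine Filter.Tendsto.atTop_div_const hA (Filter.Tendsto.atTop_mul_const hT
    (Filter.Tendsto.const_mul_atTop hB ((Real.tendsto_logb_atTop (by norm_num)).comp
      (Filter.tendsto_atTop_add_const_left _ _ (Filter.Tendsto.atTop_div_const (by positivity)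
        (Filter.Tendsto.const_mul_atTop hPsi Filter.tendsto_id))))))

lemma innerLt (B Psi Ups T A β c d r : ℝ) (hB : 0 < B) (hPsi : 0 < Psi) (hUps : 0 < Ups)
    (hT : 0 < T) (hA : 0 < A) (hc : 0 ≤ c) (hcd : c < d) (hr : 0 < r) :
    (∫ u in Set.Ioi (0 : ℝ), min (Cchan2 B Psi Ups β u r * T / A) c * Real.exp (-u)) <
    ∫ u in Set.Ioi (0 : ℝ), min (Cchan2 B Psi Ups β u r * T / A) d * Real.exp (-u) := by
  have i1 := innerInt B Psi Ups T A β c r hB hPsi hUps hT hA hc hr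
  have i2 := innerInt B Psi Ups T A β d r hB hPsi hUps hT hA (hc.trans hcd.le) hr
  rw [← sub_pos, ← integral_sub i2 i1]
  have hnn : ∀ u, 0 ≤ min (Cchan2 B Psi Ups β u r * T / A) d * Real.exp (-u) -
      min (Cchan2 B Psi Ups β u r * T / A) c * Real.exp (-u) := by
    intro u
    rw [sub_nonneg]
    gcongr
  rw [integral_pos_iff_support_of_nonneg hnn (i2.sub i1)]
  obtain ⟨N, hN⟩ := Filter.eventually_atTop.1
    ((Ctends B Psi Ups T A β r hB hPsi hUps hT hA hr).eventually_ge_atTop d)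
  have hsub : Set.Ioi (max N 0) ⊆ (Function.support fun u =>
      min (Cchan2 B Psi Ups β u r * T / A) d * Real.exp (-u) -
      min (Cchan2 B Psi Ups β u r * T / A) c * Real.exp (-u)) ∩ Set.Ioi 0 := by
    intro u hu
    rw [Set.mem_Ioi, max_lt_iff] at hu
    refine ⟨?_, hu.2⟩
    have h := hN u hu.1.le
    rw [Function.mem_support, min_eq_right h, min_eq_right (hcd.le.trans h), ← sub_mul]
    exact (mul_pos (sub_pos.2 hcd) (Real.exp_pos _)).ne'
  rw [Measure.restrict_apply' measurableSet_Ioi]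
  refine lt_of_lt_of_le ?_ (measure_mono hsub)
  simp

theorem stmt_14 (B Psi Ups T A qmax R β : ℝ)
    (hB : 0 < B) (hPsi : 0 < Psi) (hUps : 0 < Ups) (hT : 0 < T)
    (hA : 0 < A) (hq : 0 < qmax) (hR : 0 < R) (hβ : 0 < β)
    (x : ℝ) (hx0 : 0 < x) (hxq : x ≤ qmax) :
    ∀ α ∈ Set.Icc (x / qmax) 1,
      (x + Hfun B Psi Ups T A qmax R β α ≤
        x + Hfun B Psi Ups T A qmax R β (x / qmax)) ∧
      (α ≠ x / qmax →
        x + Hfun B Psi Ups T A qmax R β α <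
          x + Hfun B Psi Ups T A qmax R β (x / qmax)) := by
  have key : ∀ α ∈ Set.Icc (x / qmax) 1, α ≠ x / qmax →
      Hfun B Psi Ups T A qmax R β α < Hfun B Psi Ups T A qmax R β (x / qmax) := by
    intro α hα hne
    have hlt : x / qmax < α := lt_of_le_of_ne hα.1 (Ne.symm hne)
    have hc : 0 ≤ qmax * (1 - α) := mul_nonneg hq.le (sub_nonneg.2 hα.2)
    have hcd : qmax * (1 - α) < qmax * (1 - x / qmax) := by gcongr
    have i1 := outerInt B Psi Ups T A R β _ hB hPsi hUps hT hA hR hc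
    have i2 := outerInt B Psi Ups T A R β _ hB hPsi hUps hT hA hR (hc.trans hcd.le)
    unfold Hfun
    rw [← sub_pos, ← intervalIntegral.integral_sub i2 i1]
    refine intervalIntegral.intervalIntegral_pos_of_pos_on (i2.sub i1) ?_ hR
    intro r hr
    have h := innerLt B Psi Ups T A β _ _ r hB hPsi hUps hT hA hc hcd hr.1
    have hr0 := hr.1
    rw [sub_pos]
    exact mul_lt_mul_of_pos_right h (by positivity)
  intro α hα
  refine ⟨?_, fun hne => by linarith [key α hα hne]⟩
  by_cases hne : α = x / qmax
  · rw [hne]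
  · linarith [key α hα hne]
end

section
/- The function Ψ₀(x) := x + H(x/q_max) is differentiable on (0, q_max) with derivative Ψ₀′(x) = 1 − ∫₀^R e^{−l(x/q_max)·r^β}·(2r/R²) dr; this derivative lies strictly between 0 and 1, so Ψ₀ is strictly increasing on [0, q_max]. -/
open Real MeasureTheory

lemma aux_int_s16 (g : ℝ → ℝ) (hg : Measurable g) (h0 : ∀ u, 0 < u → 0 ≤ g u) (c : ℝ) :
    IntegrableOn (fun u => min (g u) c * Real.exp (-u)) (Set.Ioi 0) := by
  have hE : IntegrableOn (fun u : ℝ => |c| * Real.exp (-u)) (Set.Ioi 0) :=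
    (integrableOn_exp_neg_Ioi 0).const_mul _
  refine Integrable.mono' hE (by fun_prop) ?_
  filter_upwards [ae_restrict_mem measurableSet_Ioi] with u hu
  rw [norm_mul, Real.norm_eq_abs, Real.norm_eq_abs, abs_of_pos (Real.exp_pos _)]
  refine mul_le_mul_of_nonneg_right ?_ (by positivity)
  have := h0 u hu
  rcases le_total (g u) c with h | h
  · rw [min_eq_left h, abs_of_nonneg this]; exact h.trans (le_abs_self _)
  · rw [min_eq_right h]

lemma aux_exp : ∫ u in Set.Ioi (0:ℝ), Real.exp (-u) = 1 := by
  simpa using integral_exp_neg_Ioi 0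

lemma aux_bd (g : ℝ → ℝ) (h0 : ∀ u, 0 < u → 0 ≤ g u) (c : ℝ) :
    |∫ u in Set.Ioi (0:ℝ), min (g u) c * Real.exp (-u)| ≤ |c| := by
  have hE : IntegrableOn (fun u : ℝ => |c| * Real.exp (-u)) (Set.Ioi 0) :=
    (integrableOn_exp_neg_Ioi 0).const_mul _
  have := norm_integral_le_of_norm_le (f := fun u => min (g u) c * Real.exp (-u)) hE ?_
  · rw [integral_const_mul, aux_exp, mul_one] at this
    exact this
  filter_upwards [ae_restrict_mem measurableSet_Ioi] with u hu
  rw [norm_mul, Real.norm_eq_abs, Real.norm_eq_abs, abs_of_pos (Real.exp_pos _)]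
  refine mul_le_mul_of_nonneg_right ?_ (by positivity)
  have := h0 u hu
  rcases le_total (g u) c with h | h
  · rw [min_eq_left h, abs_of_nonneg this]; exact h.trans (le_abs_self _)
  · rw [min_eq_right h]

lemma aux_min (a c d : ℝ) : |min a c - min a d| ≤ |c - d| := by
  have := abs_min_sub_min_le_max a c a d
  simpa using this

lemma aux_lip (g : ℝ → ℝ) (hg : Measurable g) (h0 : ∀ u, 0 < u → 0 ≤ g u) (c d : ℝ) :
    |(∫ u in Set.Ioi (0:ℝ), min (g u) c * Real.exp (-u)) -
      ∫ u in Set.Ioi (0:ℝ), min (g u) d * Real.exp (-u)| ≤ |c - d| := by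
  rw [← integral_sub (aux_int_s16 g hg h0 c) (aux_int_s16 g hg h0 d)]
  have hE : IntegrableOn (fun u : ℝ => |c - d| * Real.exp (-u)) (Set.Ioi 0) :=
    (integrableOn_exp_neg_Ioi 0).const_mul _
  have := norm_integral_le_of_norm_le
    (f := fun u => min (g u) c * Real.exp (-u) - min (g u) d * Real.exp (-u)) hE ?_
  · rw [integral_const_mul, aux_exp, mul_one] at this
    exact this
  filter_upwards with u
  rw [← sub_mul, norm_mul, Real.norm_eq_abs, Real.norm_eq_abs, abs_of_pos (Real.exp_pos _)]
  refine mul_le_mul_of_nonneg_right ?_ (by positivity)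
  exact aux_min _ _ _

/-- inner derivative -/
lemma aux_der (g : ℝ → ℝ) (hg : Measurable g) (h0 : ∀ u, 0 < u → 0 ≤ g u) (q x t : ℝ)
    (ht : 0 ≤ t) (h1 : ∀ u, 0 < u → u < t → g u < q - x) (h2 : ∀ u, t < u → q - x < g u) :
    HasDerivAt (fun y => ∫ u in Set.Ioi (0:ℝ), min (g u) (q - y) * Real.exp (-u))
      (-Real.exp (-t)) x := by
  have key := hasDerivAt_integral_of_dominated_loc_of_lip (μ := volume.restrict (Set.Ioi (0:ℝ)))
    (F := fun y u => min (g u) (q - y) * Real.exp (-u)) (x₀ := x) (s := Set.univ)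
    (F' := (Set.Ioi t).indicator (fun u => -Real.exp (-u)))
    (bound := fun u => Real.exp (-u)) Filter.univ_mem
    (Filter.Eventually.of_forall fun y => (aux_int_s16 g hg h0 (q - y)).aestronglyMeasurable)
    (aux_int_s16 g hg h0 (q - x))
    (Measurable.aestronglyMeasurable
      (Measurable.indicator (by fun_prop) measurableSet_Ioi))
    ?_ (integrableOn_exp_neg_Ioi 0) ?_
  · have h := key.2
    rw [setIntegral_indicator measurableSet_Ioi, Set.Ioi_inter_Ioi, sup_eq_right.2 ht,
      integral_neg, integral_exp_neg_Ioi] at h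
    exact h
  · filter_upwards with u
    refine LipschitzOnWith.of_dist_le_mul fun a _ b _ => ?_
    rw [Real.dist_eq, Real.dist_eq, ← sub_mul, abs_mul, Real.coe_nnabs,
      abs_of_pos (Real.exp_pos _), mul_comm]
    refine mul_le_mul_of_nonneg_left ?_ (by positivity)
    refine (aux_min _ _ _).trans (le_of_eq ?_)
    rw [abs_sub_comm]; congr 1; ring
  · have hne : ∀ᵐ u ∂(volume.restrict (Set.Ioi (0:ℝ))), u ≠ t :=
      ae_restrict_of_ae (by simp [ae_iff])
    filter_upwards [ae_restrict_mem measurableSet_Ioi, hne] with u hu hut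
    have hc : ContinuousAt (fun y : ℝ => q - y) x := by fun_prop
    rcases lt_or_gt_of_ne hut with h | h
    · rw [Set.indicator_of_notMem (by simp [h.le])]
      have h3 := hc.eventually_const_lt (h1 u hu h)
      refine (hasDerivAt_const x (g u * Real.exp (-u))).congr_of_eventuallyEq ?_
      filter_upwards [h3] with y hy
      rw [min_eq_left hy.le]
    · rw [Set.indicator_of_mem (by exact h)]
      have h3 := hc.eventually_lt_const (h2 u h)
      have h4 : HasDerivAt (fun y : ℝ => (q - y) * Real.exp (-u)) (-Real.exp (-u)) x := by
        simpa using ((hasDerivAt_id x).const_sub q).mul_const (Real.exp (-u))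
      refine h4.congr_of_eventuallyEq ?_
      filter_upwards [h3] with y hy
      rw [min_eq_right hy.le]

lemma aux_wint (R : ℝ) (hR : 0 < R) : ∫ r in (0:ℝ)..R, 2 * r / R ^ 2 = 1 := by
  rw [intervalIntegral.integral_div, intervalIntegral.integral_const_mul, integral_id]
  field_simp
  ring

section outer
variable (g : ℝ → ℝ → ℝ) (hg : Measurable (Function.uncurry g))
  (h0 : ∀ r u, 0 < r → 0 < u → 0 ≤ g r u) (q R : ℝ) (hR : 0 < R)

lemma aux_meas (g : ℝ → ℝ → ℝ) (hg : Measurable (Function.uncurry g)) (c : ℝ) (R : ℝ) :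
    Measurable (fun r => (∫ u in Set.Ioi (0:ℝ), min (g r u) c * Real.exp (-u)) *
      (2 * r / R ^ 2)) := by
  refine Measurable.mul ?_ (by fun_prop)
  refine (StronglyMeasurable.integral_prod_right (ν := volume.restrict (Set.Ioi (0:ℝ)))
    (f := fun r u => min (g r u) c * Real.exp (-u)) ?_).measurable
  apply Measurable.stronglyMeasurable
  exact (hg.min measurable_const).mul (by fun_prop)

lemma aux_oint (g : ℝ → ℝ → ℝ) (hg : Measurable (Function.uncurry g))
    (h0 : ∀ r u, 0 < r → 0 < u → 0 ≤ g r u) (c R : ℝ) (hR : 0 < R) :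
    IntervalIntegrable (fun r => (∫ u in Set.Ioi (0:ℝ), min (g r u) c * Real.exp (-u)) *
      (2 * r / R ^ 2)) volume 0 R := by
  have hw : IntervalIntegrable (fun r : ℝ => |c| * (2 * r / R ^ 2)) volume 0 R :=
    Continuous.intervalIntegrable (by fun_prop) _ _
  refine hw.mono_fun (aux_meas g hg c R).aestronglyMeasurable ?_
  filter_upwards [ae_restrict_mem measurableSet_uIoc] with r hr
  rw [Set.uIoc_of_le hR.le] at hr
  rw [norm_mul, norm_mul]
  gcongr
  rw [Real.norm_eq_abs, Real.norm_eq_abs, abs_abs]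
  exact aux_bd (g r) (fun u hu => h0 r u hr.1 hu) c

lemma aux_olip (g : ℝ → ℝ → ℝ) (hg : Measurable (Function.uncurry g))
    (h0 : ∀ r u, 0 < r → 0 < u → 0 ≤ g r u) (c d R : ℝ) (hR : 0 < R) :
    |(∫ r in (0:ℝ)..R, (∫ u in Set.Ioi (0:ℝ), min (g r u) c * Real.exp (-u)) * (2 * r / R ^ 2)) -
     ∫ r in (0:ℝ)..R, (∫ u in Set.Ioi (0:ℝ), min (g r u) d * Real.exp (-u)) * (2 * r / R ^ 2)|
      ≤ |c - d| := by
  rw [← intervalIntegral.integral_sub (aux_oint g hg h0 c R hR) (aux_oint g hg h0 d R hR)]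
  have hw : IntervalIntegrable (fun r : ℝ => |c - d| * (2 * r / R ^ 2)) volume 0 R :=
    Continuous.intervalIntegrable (by fun_prop) _ _
  have := intervalIntegral.norm_integral_le_of_norm_le (μ := volume) hR.le
    (f := fun r => (∫ u in Set.Ioi (0:ℝ), min (g r u) c * Real.exp (-u)) * (2 * r / R ^ 2) -
      (∫ u in Set.Ioi (0:ℝ), min (g r u) d * Real.exp (-u)) * (2 * r / R ^ 2))
    (g := fun r => |c - d| * (2 * r / R ^ 2)) ?_ hw
  · rw [intervalIntegral.integral_const_mul, aux_wint R hR, mul_one] at this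
    exact this
  · filter_upwards with r hr
    have hr0 := hr.1
    rw [← sub_mul, norm_mul, Real.norm_eq_abs, Real.norm_eq_abs,
      abs_of_nonneg (show 0 ≤ 2 * r / R ^ 2 by positivity)]
    refine mul_le_mul_of_nonneg_right ?_ (by positivity)
    exact aux_lip (g r) (hg.of_uncurry_left) (fun u hu => h0 r u hr.1 hu) c d

lemma aux_oder (g : ℝ → ℝ → ℝ) (hg : Measurable (Function.uncurry g))
    (h0 : ∀ r u, 0 < r → 0 < u → 0 ≤ g r u) (q x R : ℝ) (hR : 0 < R) (t : ℝ → ℝ)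
    (htm : Measurable t) (ht : ∀ r, 0 < r → 0 ≤ t r)
    (h1 : ∀ r u, 0 < r → 0 < u → u < t r → g r u < q - x)
    (h2 : ∀ r u, 0 < r → t r < u → q - x < g r u) :
    HasDerivAt (fun y => ∫ r in (0:ℝ)..R,
        (∫ u in Set.Ioi (0:ℝ), min (g r u) (q - y) * Real.exp (-u)) * (2 * r / R ^ 2))
      (∫ r in (0:ℝ)..R, -Real.exp (-t r) * (2 * r / R ^ 2)) x := by
  have key := intervalIntegral.hasDerivAt_integral_of_dominated_loc_of_lip (μ := volume)
    (F := fun y r => (∫ u in Set.Ioi (0:ℝ), min (g r u) (q - y) * Real.exp (-u)) *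
      (2 * r / R ^ 2)) (x₀ := x) (s := Set.univ) (a := 0) (b := R)
    (F' := fun r => -Real.exp (-t r) * (2 * r / R ^ 2))
    (bound := fun r => 2 * r / R ^ 2) Filter.univ_mem
    (Filter.Eventually.of_forall fun y => (aux_meas g hg (q - y) R).aestronglyMeasurable)
    (aux_oint g hg h0 (q - x) R hR)
    (Measurable.aestronglyMeasurable (by fun_prop))
    ?_ (Continuous.intervalIntegrable (by fun_prop) _ _) ?_
  · exact key.2
  · filter_upwards with r hr
    rw [Set.uIoc_of_le hR.le] at hr
    have hr0 := hr.1
    have hw : 0 ≤ 2 * r / R ^ 2 := by positivity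
    refine LipschitzOnWith.of_dist_le_mul fun a _ b _ => ?_
    rw [Real.dist_eq, Real.dist_eq, ← sub_mul, abs_mul, Real.coe_nnabs,
      abs_of_nonneg hw, mul_comm]
    refine mul_le_mul_of_nonneg_left ?_ (by positivity)
    refine (aux_lip (g r) (hg.of_uncurry_left) (fun u hu => h0 r u hr.1 hu) _ _).trans
      (le_of_eq ?_)
    rw [abs_sub_comm]; congr 1; ring
  · filter_upwards with r hr
    rw [Set.uIoc_of_le hR.le] at hr
    exact (aux_der (g r) (hg.of_uncurry_left) (fun u hu => h0 r u hr.1 hu) q x (t r)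
      (ht r hr.1) (fun u => h1 r u hr.1) (fun u => h2 r u hr.1)).mul_const _
end outer

lemma aux_iff (B Psi Ups T A β r u c : ℝ)
    (hB : 0 < B) (hPsi : 0 < Psi) (hUps : 0 < Ups) (hT : 0 < T)
    (hA : 0 < A) (hr : 0 < r) (hu : 0 < u) :
    (Cchan2 B Psi Ups β u r * T / A < c ↔
      u < (Ups + 1) / Psi * ((2:ℝ) ^ (A * c / (T * B)) - 1) * r ^ β) ∧
    (c < Cchan2 B Psi Ups β u r * T / A ↔
      (Ups + 1) / Psi * ((2:ℝ) ^ (A * c / (T * B)) - 1) * r ^ β < u) := by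
  have hrb : 0 < r ^ β := Real.rpow_pos_of_pos hr β
  unfold Cchan2
  have hp : 0 < 1 + Psi * u / (r ^ β * (Ups + 1)) := by positivity
  constructor
  · have e1 : B * Real.logb 2 (1 + Psi * u / (r ^ β * (Ups + 1))) * T / A < c ↔
        Real.logb 2 (1 + Psi * u / (r ^ β * (Ups + 1))) < A * c / (T * B) := by
      rw [div_lt_iff₀ hA, lt_div_iff₀ (by positivity)]
      constructor <;> intro h <;> linarith
    rw [e1, Real.logb_lt_iff_lt_rpow (by norm_num) hp, ← lt_sub_iff_add_lt',
      div_lt_iff₀ (by positivity)]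
    generalize (2:ℝ) ^ (A * c / (T * B)) - 1 = z
    rw [show (Ups + 1) / Psi * z * r ^ β = (z * (r ^ β * (Ups + 1))) / Psi by ring,
      lt_div_iff₀ hPsi, mul_comm u]
  · have e1 : c < B * Real.logb 2 (1 + Psi * u / (r ^ β * (Ups + 1))) * T / A ↔
        A * c / (T * B) < Real.logb 2 (1 + Psi * u / (r ^ β * (Ups + 1))) := by
      rw [lt_div_iff₀ hA, div_lt_iff₀ (by positivity)]
      constructor <;> intro h <;> linarith
    rw [e1, Real.lt_logb_iff_rpow_lt (by norm_num) hp, ← sub_lt_iff_lt_add',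
      lt_div_iff₀ (by positivity)]
    generalize (2:ℝ) ^ (A * c / (T * B)) - 1 = z
    rw [show (Ups + 1) / Psi * z * r ^ β = (z * (r ^ β * (Ups + 1))) / Psi by ring,
      div_lt_iff₀ hPsi, mul_comm u]

theorem stmt_16 (B Psi Ups T A qmax R β : ℝ)
    (hB : 0 < B) (hPsi : 0 < Psi) (hUps : 0 < Ups) (hT : 0 < T)
    (hA : 0 < A) (hq : 0 < qmax) (hR : 0 < R) (hβ : 0 < β) :
    (∀ x ∈ Set.Ioo (0 : ℝ) qmax,
      HasDerivAt (fun y => y + Hfun B Psi Ups T A qmax R β (y / qmax))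
        (1 - ∫ r in (0 : ℝ)..R,
          Real.exp (-(lThr B Psi Ups T A qmax (x / qmax) * r ^ β)) * (2 * r / R ^ 2)) x ∧
      0 < 1 - ∫ r in (0 : ℝ)..R,
          Real.exp (-(lThr B Psi Ups T A qmax (x / qmax) * r ^ β)) * (2 * r / R ^ 2) ∧
      (1 - ∫ r in (0 : ℝ)..R,
          Real.exp (-(lThr B Psi Ups T A qmax (x / qmax) * r ^ β)) * (2 * r / R ^ 2)) < 1) ∧
    StrictMonoOn (fun y => y + Hfun B Psi Ups T A qmax R β (y / qmax))
      (Set.Icc 0 qmax) := by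
  have hHeq : ∀ y, Hfun B Psi Ups T A qmax R β (y / qmax) = ∫ r in (0:ℝ)..R,
      (∫ u in Set.Ioi (0:ℝ), min ((fun r u => Cchan2 B Psi Ups β u r * T / A) r u) (qmax - y)
        * Real.exp (-u)) * (2 * r / R ^ 2) := by
    intro y
    have : qmax * (1 - y / qmax) = qmax - y := by field_simp
    simp only [Hfun, this]
  have hg : Measurable (Function.uncurry (fun r u => Cchan2 B Psi Ups β u r * T / A)) := by
    unfold Cchan2 Real.logb Function.uncurry
    fun_prop
  have h0 : ∀ r u, 0 < r → 0 < u → 0 ≤ (fun r u => Cchan2 B Psi Ups β u r * T / A) r u := by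
    intro r u hr hu
    have hrb : 0 < r ^ β := Real.rpow_pos_of_pos hr β
    have : 0 ≤ Real.logb 2 (1 + Psi * u / (r ^ β * (Ups + 1))) := by
      apply Real.logb_nonneg (by norm_num)
      have : 0 ≤ Psi * u / (r ^ β * (Ups + 1)) := by positivity
      linarith
    simp only [Cchan2]
    positivity
  have hl : ∀ x, lThr B Psi Ups T A qmax (x / qmax) =
      (Ups + 1) / Psi * ((2:ℝ) ^ (A * (qmax - x) / (T * B)) - 1) := by
    intro x
    have : A * qmax * (1 - x / qmax) = A * (qmax - x) := by field_simp
    simp only [lThr, this]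
  have hmain : ∀ x ∈ Set.Ioo (0 : ℝ) qmax,
      HasDerivAt (fun y => y + Hfun B Psi Ups T A qmax R β (y / qmax))
        (1 - ∫ r in (0 : ℝ)..R,
          Real.exp (-(lThr B Psi Ups T A qmax (x / qmax) * r ^ β)) * (2 * r / R ^ 2)) x ∧
      0 < 1 - ∫ r in (0 : ℝ)..R,
          Real.exp (-(lThr B Psi Ups T A qmax (x / qmax) * r ^ β)) * (2 * r / R ^ 2) ∧
      (1 - ∫ r in (0 : ℝ)..R,
          Real.exp (-(lThr B Psi Ups T A qmax (x / qmax) * r ^ β)) * (2 * r / R ^ 2)) < 1 := by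
    intro x hx
    have hlpos : 0 < lThr B Psi Ups T A qmax (x / qmax) := by
      rw [hl]
      have h1 : 0 < qmax - x := sub_pos.2 hx.2
      have : 1 < (2:ℝ) ^ (A * (qmax - x) / (T * B)) :=
        Real.one_lt_rpow (by norm_num) (by positivity)
      have := sub_pos.2 this
      positivity
    have hcont : Continuous fun r : ℝ =>
        Real.exp (-(lThr B Psi Ups T A qmax (x / qmax) * r ^ β)) * (2 * r / R ^ 2) := by
      have := Real.continuous_rpow_const hβ.le
      fun_prop
    refine ⟨?_, ?_, ?_⟩
    · have := aux_oder _ hg h0 qmax x R hR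
        (fun r => lThr B Psi Ups T A qmax (x / qmax) * r ^ β) (by fun_prop)
        (fun r hr => mul_nonneg hlpos.le (Real.rpow_nonneg hr.le _))
        (fun r u hr hu h => (aux_iff B Psi Ups T A β r u _ hB hPsi hUps hT hA hr hu).1.2
          (by rw [← hl]; exact h))
        (fun r u hr h => (aux_iff B Psi Ups T A β r u _ hB hPsi hUps hT hA hr
          (lt_of_le_of_lt (mul_nonneg hlpos.le (Real.rpow_nonneg hr.le _)) h)).2.2
          (by rw [← hl]; exact h))
      simp only [← hHeq, neg_mul, intervalIntegral.integral_neg] at this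
      rw [sub_eq_add_neg]
      exact (hasDerivAt_id x).add this
    · rw [← aux_wint R hR, ← intervalIntegral.integral_sub
        (Continuous.intervalIntegrable (by fun_prop) _ _) (hcont.intervalIntegrable _ _)]
      refine intervalIntegral.intervalIntegral_pos_of_pos_on
        (Continuous.intervalIntegrable (by fun_prop) _ _) ?_ hR
      intro r hr
      have hr0 := hr.1
      have hw : 0 < 2 * r / R ^ 2 := by positivity
      have : 0 < lThr B Psi Ups T A qmax (x / qmax) * r ^ β := by positivity
      have : Real.exp (-(lThr B Psi Ups T A qmax (x / qmax) * r ^ β)) < 1 := by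
        rw [Real.exp_lt_one_iff]; linarith
      nlinarith
    · have := intervalIntegral.intervalIntegral_pos_of_pos_on
        (hcont.intervalIntegrable 0 R) (fun r hr => by
          have hr0 := hr.1
          positivity) hR
      linarith
  refine ⟨hmain, ?_⟩
  refine strictMonoOn_of_deriv_pos (convex_Icc _ _) ?_ ?_
  · refine Continuous.continuousOn (continuous_id.add ?_)
    have : LipschitzWith 1 (fun y => Hfun B Psi Ups T A qmax R β (y / qmax)) := by
      refine LipschitzWith.of_dist_le_mul fun a b => ?_
      rw [Real.dist_eq, Real.dist_eq, hHeq, hHeq]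
      refine (aux_olip _ hg h0 _ _ R hR).trans (le_of_eq ?_)
      rw [NNReal.coe_one, one_mul, abs_sub_comm]; congr 1; ring
    exact this.continuous
  · intro x hx
    rw [interior_Icc] at hx
    rw [(hmain x hx).1.deriv]
    exact (hmain x hx).2.1
end
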